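/- arXiv:2007.12295 — 2 statements merged into one kernel-verified Lean document; each statement's English description precedes it below -/
import Mathlib

section
/- For n : ℕ, let U n denote the number of up-down permutations of length n, i.e., the cardinality of the set of bijections a : Fin n ≃ Fin n satisfying a(i) < a(i+1) whenever i is even and a(i) > a(i+1) whenever i is odd (for all valid indices i with i+1 < n). Then for every natural number n ≥ 1, U(2n−1) = (2^{2n} · (2^{2n} − 1) / (2n)) · (−1)^{n−1} · B_{2n}, as an identity in ℚ after casting U(2n−1), where B_{2n} is Mathlib's 2n-th Bernoulli number. -/
/-- The number of up-down permutations of length `n`: bijections `a : Fin n ≃ Fin n`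
with `a 0 < a 1 > a 2 < a 3 > ⋯`. -/
noncomputable def upDownCount (n : ℕ) : ℕ :=
  Nat.card {a : Fin n ≃ Fin n //
    ∀ i : ℕ, (h : i + 1 < n) →
      (Even i → a ⟨i, Nat.lt_of_succ_lt h⟩ < a ⟨i + 1, h⟩) ∧
      (Odd i → a ⟨i + 1, h⟩ < a ⟨i, Nat.lt_of_succ_lt h⟩)}

section GeneratingFunction

open PowerSeries

theorem eq_of_derivative_eq_one_sub_sq {F G : ℚ⟦X⟧} (hF : d⁄dX ℚ F = 1 - F ^ 2)
    (hG : d⁄dX ℚ G = 1 - G ^ 2) (h : constantCoeff F = constantCoeff G) : F = G := by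
  ext n
  induction n using Nat.strong_induction_on with
  | _ n ih =>
    obtain _ | n := n
    · simpa using h
    · have hn : ((n : ℚ) + 1) ≠ 0 := by positivity
      apply mul_right_cancel₀ hn
      rw [← coeff_derivative, ← coeff_derivative, hF, hG, map_sub, map_sub, sq, sq, coeff_mul,
        coeff_mul]
      congr 1
      refine Finset.sum_congr rfl fun p hp => ?_
      have := Finset.HasAntidiagonal.mem_antidiagonal.1 hp
      rw [ih p.1 (by omega), ih p.2 (by omega)]

/-- The power series of `tanh`, with coefficients expressed through Bernoulli numbers. -/
noncomputable def tanhSeries : ℚ⟦X⟧ :=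
  PowerSeries.mk fun k =>
    if k = 0 then 0 else 2 ^ (k + 1) * (2 ^ (k + 1) - 1) * bernoulli (k + 1) / (k + 1).factorial

theorem X_mul_tanhSeries : X * tanhSeries =
    rescale 4 (bernoulliPowerSeries ℚ) - rescale 2 (bernoulliPowerSeries ℚ) + X := by
  ext n
  obtain _ | _ | n := n
  · rw [map_add, map_sub, coeff_rescale, coeff_rescale]
    simp
  · simp [tanhSeries, coeff_succ_X_mul, bernoulliPowerSeries]
    norm_num
  · simp only [coeff_succ_X_mul, tanhSeries, coeff_mk, map_add, map_sub, coeff_rescale,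
      bernoulliPowerSeries, coeff_X]
    rw [if_neg (by omega), if_neg (by omega), show (4 : ℚ) = 2 * 2 by norm_num, mul_pow]
    simp
    ring

theorem tanhSeries_mul_exp_sq_add_one : tanhSeries * (exp ℚ ^ 2 + 1) = exp ℚ ^ 2 - 1 := by
  have h2 := congrArg (rescale (2 : ℚ)) (bernoulliPowerSeries_mul_exp_sub_one ℚ)
  have h4 := congrArg (rescale (4 : ℚ)) (bernoulliPowerSeries_mul_exp_sub_one ℚ)
  have e2 : rescale (2 : ℚ) (exp ℚ) = exp ℚ ^ 2 := by
    simpa using (exp_pow_eq_rescale_exp (A := ℚ) 2).symm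
  have e4 : rescale (4 : ℚ) (exp ℚ) = exp ℚ ^ 4 := by
    simpa using (exp_pow_eq_rescale_exp (A := ℚ) 4).symm
  rw [map_mul, map_sub, map_one, rescale_X] at h2 h4
  rw [e2] at h2
  rw [e4] at h4
  have c2 : (C (2 : ℚ)) = (2 : ℚ⟦X⟧) := map_ofNat C 2
  have c4 : (C (4 : ℚ)) = (4 : ℚ⟦X⟧) := map_ofNat C 4
  rw [c2] at h2
  rw [c4] at h4
  have hE : exp ℚ ^ 2 - 1 ≠ 0 := by
    intro h
    have := congrArg (coeff 1) h
    rw [← e2] at this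
    simp [coeff_rescale, coeff_exp] at this
  refine mul_left_cancel₀ (mul_ne_zero X_ne_zero hE) ?_
  linear_combination (exp ℚ ^ 4 - 1) * X_mul_tanhSeries + h4 - (exp ℚ ^ 2 + 1) * h2

theorem derivative_tanhSeries : d⁄dX ℚ tanhSeries = 1 - tanhSeries ^ 2 := by
  have h := tanhSeries_mul_exp_sq_add_one
  have hd := congrArg (d⁄dX ℚ) h
  have he : d⁄dX ℚ (exp ℚ) = exp ℚ := by
    ext n
    simp [coeff_derivative, coeff_exp, Nat.factorial_succ]
    field_simp
  simp only [Derivation.leibniz, Derivation.leibniz_pow, map_add, map_sub, he, smul_eq_mul,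
    Derivation.map_one_eq_zero] at hd
  have hE : exp ℚ ^ 2 + 1 ≠ 0 := by
    intro h
    have := congrArg constantCoeff h
    simp at this
  simp at hd
  refine mul_left_cancel₀ (pow_ne_zero 2 hE) ?_
  linear_combination (exp ℚ ^ 2 + 1) * hd + (tanhSeries * (exp ℚ ^ 2 + 1) - exp ℚ ^ 2 - 1) * h

end GeneratingFunction

section UpDownList

variable {α : Type*} [LinearOrder α]

/-- A list `l` is up-down if `l[0] < l[1] > l[2] < ⋯`. -/
def IsUpDown (l : List α) : Prop :=
  ∀ (i : ℕ) (h : i + 1 < l.length), (Even i → l[i] < l[i + 1]) ∧ (Odd i → l[i + 1] < l[i])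

theorem isUpDown_append_cons_iff {l₁ l₂ : List α} {m : α} (h₁ : ∀ x ∈ l₁, x < m)
    (h₂ : ∀ x ∈ l₂, x < m) (hl : Odd l₁.length) :
    IsUpDown (l₁ ++ m :: l₂) ↔ IsUpDown l₁ ∧ IsUpDown l₂ := by
  constructor
  · refine fun h => ⟨fun i hi => ?_, fun i hi => ?_⟩
    · have := h i (by simp; omega)
      grind
    · have := h (l₁.length + 1 + i) (by simp; omega)
      grind
  · rintro ⟨h, h'⟩ i hi
    rcases lt_trichotomy (i + 1) l₁.length with hlt | heq | hgt
    · have := h i hlt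
      grind
    · grind
    · obtain hi' | ⟨k, rfl⟩ : i = l₁.length ∨ ∃ k, i = l₁.length + 1 + k := by
        rcases Nat.exists_eq_add_of_lt hgt with ⟨k, hk⟩
        obtain _ | k := k
        · left; omega
        · right; exact ⟨k, by omega⟩
      · grind
      · have := h' k (by grind)
        grind

theorem IsUpDown.odd_length_left {l₁ l₂ : List α} {m : α} (h₁ : ∀ x ∈ l₁, x < m)
    (h₂ : ∀ x ∈ l₂, x < m) (hne : l₁ ++ l₂ ≠ []) (hl : Even (l₁ ++ l₂).length)
    (h : IsUpDown (l₁ ++ m :: l₂)) : Odd l₁.length := by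
  by_contra hodd
  rw [Nat.not_odd_iff_even] at hodd
  obtain rfl | hl₂ := eq_or_ne l₂ []
  · have := h (l₁.length - 1) (by grind)
    grind
  · have := h l₁.length (by have := List.length_pos_of_ne_nil hl₂; simp; omega)
    grind

/-- The up-down lists enumerating the finite set `s` without repetition. -/
abbrev UpDownList (s : Finset α) : Type _ :=
  {l : List α // l.Nodup ∧ l.toFinset = s ∧ IsUpDown l}

/-- Up-down permutations of `Fin s.card` correspond to up-down enumerations of `s`. -/
noncomputable def upDownListEquiv (s : Finset α) :
    {a : Fin s.card ≃ Fin s.card //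
      ∀ i : ℕ, (h : i + 1 < s.card) →
        (Even i → a ⟨i, Nat.lt_of_succ_lt h⟩ < a ⟨i + 1, h⟩) ∧
        (Odd i → a ⟨i + 1, h⟩ < a ⟨i, Nat.lt_of_succ_lt h⟩)} ≃ UpDownList s :=
  Equiv.ofBijective
    (fun a => ⟨List.ofFn fun i => s.orderEmbOfFin rfl (a.1 i), by
      refine ⟨List.nodup_ofFn.2 ((s.orderEmbOfFin rfl).injective.comp a.1.injective), ?_, ?_⟩
      · rw [← Finset.coe_inj, ← Finset.range_orderEmbOfFin s rfl]
        ext x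
        simp only [List.coe_toFinset, Set.mem_ofPred_eq, List.mem_ofFn, Set.mem_range]
        exact ⟨fun ⟨i, hi⟩ => ⟨a.1 i, hi⟩, fun ⟨i, hi⟩ => ⟨a.1.symm i, by simpa using hi⟩⟩
      · intro i h
        simpa using a.2 i (by simpa using h)⟩) <| by
    refine ⟨fun a b hab => ?_, ?_⟩
    · have := List.ofFn_injective (congrArg Subtype.val hab)
      exact Subtype.ext (Equiv.ext fun i => by simpa using congrFun this i)
    · rintro ⟨l, hl, rfl, h⟩
      have hlen : l.toFinset.card = l.length := List.toFinset_card_of_nodup hl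
      let a (i : Fin l.toFinset.card) : Fin l.toFinset.card :=
        (l.toFinset.orderIsoOfFin rfl).symm ⟨l[i], by simp⟩
      have ha : ∀ i, l.toFinset.orderEmbOfFin rfl (a i) = l[i] := fun i => by
        rw [← Finset.coe_orderIsoOfFin_apply]
        simp [a]
      have hinj : Function.Injective a := fun i j hij => by
        have := (ha i).symm.trans ((congrArg _ hij).trans (ha j))
        exact Fin.ext ((hl.getElem_inj_iff).1 this)
      refine ⟨⟨Equiv.ofBijective a (Finite.injective_iff_bijective.1 hinj), fun i hi => ?_⟩, ?_⟩
      · simpa [a] using h i (hlen ▸ hi)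
      · apply Subtype.ext
        apply List.ext_getElem
        · simpa using hlen
        · intro i _ _
          simp [ha]

theorem card_upDownList (s : Finset α) : Nat.card (UpDownList s) = upDownCount s.card :=
  (Nat.card_congr (upDownListEquiv s)).symm

instance (s : Finset α) : Finite (UpDownList s) :=
  Finite.of_equiv _ (upDownListEquiv s)

theorem card_upDownList_insert {s : Finset α} {m : α} (hm : ∀ x ∈ s, x < m) (hs : s.Nonempty)
    (heven : Even s.card) :
    Nat.card (UpDownList (insert m s)) = ∑ t ∈ s.powerset with Odd t.card,
      Nat.card (UpDownList t) * Nat.card (UpDownList (s \ t)) := by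
  have hms : m ∉ s := fun h => lt_irrefl _ (hm m h)
  let f : (Σ t : {t // t ∈ s.powerset.filter (fun t => Odd t.card)},
      UpDownList t.1 × UpDownList (s \ t.1)) → UpDownList (insert m s) := fun p =>
    ⟨p.2.1.1 ++ m :: p.2.2.1, by
      obtain ⟨⟨t, ht⟩, ⟨l₁, hn₁, hl₁, h₁⟩, l₂, hn₂, hl₂, h₂⟩ := p
      dsimp only at hl₁ hl₂ ⊢
      simp only [← hl₁] at hl₂
      simp only [← hl₁, Finset.mem_filter, Finset.mem_powerset, List.toFinset_card_of_nodup hn₁] at ht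
      have m₁ : ∀ x ∈ l₁, x ∈ s := fun x hx => ht.1 (List.mem_toFinset.2 hx)
      have m₂ : ∀ x ∈ l₂, x ∈ s ∧ x ∉ l₁ := fun x hx => by
        simpa [hl₂] using List.mem_toFinset.2 hx
      refine ⟨?_, ?_, ?_⟩
      · grind [List.nodup_append, List.nodup_cons]
      · simp only [List.toFinset_append, List.toFinset_cons, hl₂]
        rw [Finset.union_insert, Finset.union_sdiff_of_subset ht.1]
      · exact (isUpDown_append_cons_iff (fun x hx => hm x (m₁ x hx))
          (fun x hx => hm x (m₂ x hx).1) ht.2).2 ⟨h₁, h₂⟩⟩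
  have hf : Function.Bijective f := by
    constructor
    · rintro ⟨⟨t, ht⟩, ⟨l₁, hn₁, hl₁, h₁⟩, l₂, hn₂, hl₂, h₂⟩
        ⟨⟨t', ht'⟩, ⟨l₁', hn₁', hl₁', h₁'⟩, l₂', hn₂', hl₂', h₂'⟩ h
      have h := congrArg Subtype.val h
      simp only [f] at h
      dsimp only at hl₁ hl₁' hl₂'
      have e₁ : m ∉ l₁' := fun h => hms ((Finset.mem_powerset.1 (Finset.mem_filter.1 ht').1)
        (hl₁' ▸ List.mem_toFinset.2 h))
      have e₂ : m ∉ l₂' := fun h => by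
        have := List.mem_toFinset.2 h
        rw [hl₂'] at this
        exact hms (Finset.mem_sdiff.1 this).1
      obtain ⟨rfl, -, rfl⟩ := (List.append_cons_inj_of_notMem e₁ e₂).1 h.symm
      obtain rfl : t = t' := hl₁.symm.trans hl₁'
      rfl
    · rintro ⟨l, hn, hl, h⟩
      obtain ⟨l₁, l₂, rfl⟩ := List.append_of_mem (a := m) (l := l) (by
        rw [← List.mem_toFinset, hl]; exact Finset.mem_insert_self _ _)
      have hn' : (l₁ ++ l₂).Nodup ∧ m ∉ l₁ ++ l₂ := by
        have := List.nodup_middle.1 hn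
        rw [List.nodup_cons] at this
        exact this.symm
      have hs' : (l₁ ++ l₂).toFinset = s := by
        have : insert m (l₁ ++ l₂).toFinset = insert m s := by
          rw [← hl]; simp
        rw [← Finset.erase_insert hms, ← this, Finset.erase_insert (by simpa using hn'.2)]
      subst hs'
      rw [List.toFinset_card_of_nodup hn'.1] at heven
      have m₁ : ∀ x ∈ l₁, x < m := fun x hx => hm x (by simp [hx])
      have m₂ : ∀ x ∈ l₂, x < m := fun x hx => hm x (by simp [hx])
      have hodd := h.odd_length_left m₁ m₂ (by rintro h; simp [h] at hs) heven
      obtain ⟨n₁, n₂, hd⟩ := List.nodup_append'.1 hn'.1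
      obtain ⟨h₁, h₂⟩ := (isUpDown_append_cons_iff m₁ m₂ hodd).1 h
      refine ⟨⟨⟨l₁.toFinset, ?_⟩, ⟨l₁, n₁, rfl, h₁⟩, ⟨l₂, n₂, ?_, h₂⟩⟩, rfl⟩
      · simp only [Finset.mem_filter, Finset.mem_powerset, List.toFinset_card_of_nodup n₁, hodd,
          and_true, List.toFinset_append, Finset.subset_union_left]
      · dsimp only
        rw [List.toFinset_append, Finset.union_sdiff_cancel_left]
        exact List.disjoint_toFinset_iff_disjoint.2 hd
  rw [← Nat.card_eq_of_bijective f hf, Nat.card_sigma]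
  simp only [Nat.card_prod]
  exact Finset.sum_coe_sort (s.powerset.filter fun t => Odd t.card)
    fun t => Nat.card (UpDownList t) * Nat.card (UpDownList (s \ t))

end UpDownList

theorem upDownCount_one : upDownCount 1 = 1 := by
  simp [upDownCount]

theorem upDownCount_succ {n : ℕ} (hn : Even n) (h0 : n ≠ 0) :
    upDownCount (n + 1) = ∑ p ∈ Finset.HasAntidiagonal.antidiagonal n with Odd p.1,
      n.choose p.1 * (upDownCount p.1 * upDownCount p.2) := by
  have h := card_upDownList_insert (s := Finset.range n) (m := n) (by simp) (by simpa) (by simpa)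
  rw [card_upDownList, ← Finset.range_add_one, Finset.card_range] at h
  rw [h, Finset.sum_filter, Finset.sum_filter, Finset.Nat.sum_antidiagonal_eq_sum_range_succ_mk]
  have key := Finset.sum_powerset_apply_card (x := Finset.range n)
    (fun j => if Odd j then upDownCount j * upDownCount (n - j) else 0)
  rw [Finset.card_range] at key
  simp only [smul_eq_mul, mul_ite, mul_zero] at key
  rw [← key]
  refine Finset.sum_congr rfl fun t ht => ?_
  rw [card_upDownList, card_upDownList, Finset.card_sdiff_of_subset (Finset.mem_powerset.1 ht),
    Finset.card_range]

open PowerSeries in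
/-- The exponential generating function of the odd-length up-down counts, with alternating signs. -/
noncomputable def signedUpDownSeries : ℚ⟦X⟧ :=
  PowerSeries.mk fun k => if Odd k then (-1) ^ (k / 2) * upDownCount k / k.factorial else 0

open PowerSeries in
theorem derivative_signedUpDownSeries :
    d⁄dX ℚ signedUpDownSeries = 1 - signedUpDownSeries ^ 2 := by
  ext n
  rw [coeff_derivative, map_sub, sq, coeff_mul]
  simp only [signedUpDownSeries, coeff_mk, coeff_one]
  obtain rfl | h0 := eq_or_ne n 0
  · simp [upDownCount_one]
  obtain hn | hn := Nat.even_or_odd n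
  · rw [if_pos hn.add_one, if_neg h0, zero_sub, upDownCount_succ hn h0, Finset.sum_filter,
      Nat.factorial_succ]
    push_cast
    rw [mul_div_assoc, mul_assoc, div_mul_eq_mul_div, mul_comm _ ((n : ℚ) + 1),
      mul_div_mul_left _ _ (by positivity), ← mul_div_assoc, Finset.mul_sum, Finset.sum_div,
      ← Finset.sum_neg_distrib]
    refine Finset.sum_congr rfl fun p hp => ?_
    obtain rfl := Finset.HasAntidiagonal.mem_antidiagonal.1 hp
    by_cases h1 : Odd p.1
    · have h2 : Odd p.2 := by grind
      rw [if_pos h1, if_pos h1, if_pos h2, Nat.cast_add_choose]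
      have : (p.1 + p.2 + 1) / 2 = p.1 / 2 + p.2 / 2 + 1 := by grind
      rw [this]
      field_simp
      ring
    · simp [h1]
  · rw [if_neg (by grind), if_neg h0, zero_mul, zero_sub, eq_comm, neg_eq_zero]
    refine Finset.sum_eq_zero fun p hp => ?_
    have := Finset.HasAntidiagonal.mem_antidiagonal.1 hp
    by_cases h1 : Odd p.1
    · rw [if_neg (c := Odd p.2) (by grind), mul_zero]
    · rw [if_neg h1, zero_mul]

theorem signedUpDownSeries_eq_tanhSeries : signedUpDownSeries = tanhSeries :=
  eq_of_derivative_eq_one_sub_sq derivative_signedUpDownSeries derivative_tanhSeries <| by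
    simp [← PowerSeries.coeff_zero_eq_constantCoeff_apply, signedUpDownSeries, tanhSeries]

/-- `U (2n - 1) = (2^{2n} (2^{2n} - 1) / (2n)) * (-1)^(n-1) * B_{2n}` for `n ≥ 1`,
where `U` counts up-down permutations and `B` is the Bernoulli number. -/
theorem upDownCount_odd_eq_bernoulli (n : ℕ) (hn : 1 ≤ n) :
    (upDownCount (2 * n - 1) : ℚ) =
      (2 ^ (2 * n) * (2 ^ (2 * n) - 1) / (2 * n : ℚ)) * (-1) ^ (n - 1) *
        bernoulli (2 * n) := by
  obtain ⟨m, rfl⟩ := Nat.exists_eq_add_of_le' hn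
  have h := congrArg (PowerSeries.coeff (2 * m + 1)) signedUpDownSeries_eq_tanhSeries
  simp only [signedUpDownSeries, tanhSeries, PowerSeries.coeff_mk] at h
  rw [if_pos (by simp), if_neg (by omega), show (2 * m + 1) / 2 = m by omega,
    Nat.factorial_succ (2 * m + 1)] at h
  have hs : ((-1 : ℚ) ^ m) * (-1) ^ m = 1 := by rw [← mul_pow]; simp
  rw [show 2 * (m + 1) - 1 = 2 * m + 1 by omega, show 2 * (m + 1) = 2 * m + 1 + 1 by ring,
    Nat.add_sub_cancel]
  push_cast at h ⊢
  have hf : ((2 * m + 1).factorial : ℚ) ≠ 0 := by positivity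
  field_simp at h ⊢
  linear_combination (-1 : ℚ) ^ m * h - upDownCount (2 * m + 1) * (2 * m + 2) * hs
end

section
/- For n : ℕ, let U n denote the number of up-down permutations of length n, i.e., the cardinality of the set of bijections a : Fin n ≃ Fin n satisfying a(i) < a(i+1) whenever i is even and a(i) > a(i+1) whenever i is odd (for all valid indices i with i+1 < n). Then for every natural number n ≥ 1, ∑_{j=0}^{n} binomial(2n, 2j) · (−1)ʲ · U(2j) = 0 (as an identity in ℤ, with U(2j) cast from ℕ). -/
/-- The first `k` entries of `w` alternate as in an up-down permutation. -/
def IsUpDownBelow {m : ℕ} (k : ℕ) (w : Fin m ≃ Fin m) : Prop :=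
  ∀ i : ℕ, (h : i + 1 < m) → i + 1 < k →
    (Even i → w ⟨i, Nat.lt_of_succ_lt h⟩ < w ⟨i + 1, h⟩) ∧
    (Odd i → w ⟨i + 1, h⟩ < w ⟨i, Nat.lt_of_succ_lt h⟩)

/-- The entries of `w` at the positions from `s` on increase. -/
def IsIncreasingFrom {m : ℕ} (s : ℕ) (w : Fin m ≃ Fin m) : Prop :=
  ∀ i : ℕ, (h : i + 1 < m) → s ≤ i → w ⟨i, Nat.lt_of_succ_lt h⟩ < w ⟨i + 1, h⟩

/-- The permutation of `Fin (k + l)` whose first `k` entries are the elements of `S` ordered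
according to `a`, followed by the elements of the complement in increasing order. -/
def shufflePerm {k l : ℕ} (S : Finset (Fin (k + l))) (hS : S.card = k) (hSc : Sᶜ.card = l)
    (a : Fin k ≃ Fin k) : Fin (k + l) ≃ Fin (k + l) :=
  finSumFinEquiv.symm.trans
    ((Equiv.sumCongr a (Equiv.refl (Fin l))).trans (finSumEquivOfFinset hS hSc))

section shufflePerm

variable {k l : ℕ} (S : Finset (Fin (k + l))) (hS : S.card = k) (hSc : Sᶜ.card = l)
  (a : Fin k ≃ Fin k)

theorem shufflePerm_castAdd (i : Fin k) :
    shufflePerm S hS hSc a (Fin.castAdd l i) = S.orderEmbOfFin hS (a i) := by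
  simp [shufflePerm]

theorem shufflePerm_natAdd (i : Fin l) :
    shufflePerm S hS hSc a (Fin.natAdd k i) = Sᶜ.orderEmbOfFin hSc i := by
  simp [shufflePerm]

theorem image_shufflePerm :
    Finset.univ.image (fun i => shufflePerm S hS hSc a (Fin.castAdd l i)) = S := by
  refine Finset.eq_of_subset_of_card_le ?_ ?_
  · intro x hx
    obtain ⟨i, -, rfl⟩ := Finset.mem_image.1 hx
    rw [shufflePerm_castAdd]
    exact Finset.orderEmbOfFin_mem _ _ _
  · rw [Finset.card_image_of_injective Finset.univ (f := fun i =>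
      shufflePerm S hS hSc a (Fin.castAdd l i))
      ((shufflePerm S hS hSc a).injective.comp (Fin.castAdd_injective k l))]
    simp [hS]

theorem shufflePerm_lt_iff {i j : ℕ} (hi : i < k) (hj : j < k) :
    shufflePerm S hS hSc a ⟨i, by omega⟩ < shufflePerm S hS hSc a ⟨j, by omega⟩ ↔
      a ⟨i, hi⟩ < a ⟨j, hj⟩ := by
  rw [← (S.orderEmbOfFin hS).lt_iff_lt, ← shufflePerm_castAdd S hS hSc,
    ← shufflePerm_castAdd S hS hSc]
  rfl

theorem isIncreasingFrom_shufflePerm : IsIncreasingFrom k (shufflePerm S hS hSc a) := by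
  intro i h hk
  have e (j : ℕ) (hj : j < k + l) (hkj : k ≤ j) :
      (⟨j, hj⟩ : Fin (k + l)) = Fin.natAdd k ⟨j - k, by omega⟩ := by
    ext; simp; omega
  rw [e i _ hk, e (i + 1) h (by omega), shufflePerm_natAdd, shufflePerm_natAdd,
    OrderEmbedding.lt_iff_lt]
  simp only [Fin.mk_lt_mk]
  omega

theorem exists_shufflePerm_eq {w : Fin (k + l) ≃ Fin (k + l)} (hw : IsIncreasingFrom k w)
    (hws : S = Finset.univ.image (fun i => w (Fin.castAdd l i))) :
    ∃ a : Fin k ≃ Fin k, shufflePerm S hS hSc a = w := by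
  have mem (i : Fin k) : w (Fin.castAdd l i) ∈ S := by
    rw [hws]; exact Finset.mem_image_of_mem _ (Finset.mem_univ i)
  have inj : Function.Injective
      (fun i : Fin k => (S.orderIsoOfFin hS).symm ⟨w (Fin.castAdd l i), mem i⟩) := by
    intro i j hij
    simpa using hij
  refine ⟨Equiv.ofBijective _ (Finite.injective_iff_bijective.1 inj), ?_⟩
  have mono : StrictMono (fun i : Fin l => w (Fin.natAdd k i)) := by
    cases l with
    | zero => exact fun i => i.elim0
    | succ l =>
      rw [Fin.strictMono_iff_lt_succ]
      intro i
      exact hw (k + i) (by omega) (by omega)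
  have memc (i : Fin l) : w (Fin.natAdd k i) ∈ Sᶜ := by
    rw [Finset.mem_compl, hws]
    intro h
    obtain ⟨j, -, hj⟩ := Finset.mem_image.1 h
    have := congrArg Fin.val (w.injective hj)
    simp at this
    omega
  ext1 x
  refine Fin.addCases (fun i => ?_) (fun i => ?_) x
  · rw [shufflePerm_castAdd, ← Finset.coe_orderIsoOfFin_apply]
    simp
  · rw [shufflePerm_natAdd, ← Finset.orderEmbOfFin_unique hSc memc mono]

end shufflePerm

theorem card_isUpDownBelow_isIncreasingFrom {m k : ℕ} (hk : k ≤ m) :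
    Nat.card {w : Fin m ≃ Fin m // IsUpDownBelow k w ∧ IsIncreasingFrom k w} =
      m.choose k * upDownCount k := by
  obtain ⟨l, rfl⟩ := Nat.exists_eq_add_of_le hk
  have hc (S : Finset (Fin (k + l))) (hS : S.card = k) : Sᶜ.card = l := by
    rw [Finset.card_compl, hS, Fintype.card_fin, Nat.add_sub_cancel_left]
  have hcard : Nat.card {S : Finset (Fin (k + l)) // S.card = k} = (k + l).choose k := by
    rw [Nat.card_eq_fintype_card, Fintype.card_finset_len, Fintype.card_fin]
  rw [upDownCount, ← hcard, ← Nat.card_prod]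
  symm
  refine Nat.card_eq_of_bijective
    (fun p => ⟨shufflePerm p.1.1 p.1.2 (hc _ p.1.2) p.2.1, fun i h hik => ?_,
      isIncreasingFrom_shufflePerm _ _ _ _⟩) ⟨?_, ?_⟩
  · rw [shufflePerm_lt_iff _ _ _ _ (by omega) hik, shufflePerm_lt_iff _ _ _ _ hik (by omega)]
    exact p.2.2 i hik
  · rintro ⟨⟨S, hS⟩, a, ha⟩ ⟨⟨T, hT⟩, b, hb⟩ h
    have h := congrArg Subtype.val h
    dsimp only at h
    obtain rfl : S = T := by
      rw [← image_shufflePerm S hS (hc S hS) a, h, image_shufflePerm]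
    obtain rfl : a = b := by
      ext1 i
      apply (S.orderEmbOfFin hS).injective
      rw [← shufflePerm_castAdd S hS (hc S hS), h, shufflePerm_castAdd]
    rfl
  · rintro ⟨w, hw, hw'⟩
    obtain ⟨S, hwS⟩ : ∃ S, S = Finset.univ.image (fun i => w (Fin.castAdd l i)) := ⟨_, rfl⟩
    have hS : S.card = k := by
      rw [hwS, Finset.card_image_of_injective Finset.univ (f := fun i => w (Fin.castAdd l i))
        (w.injective.comp (Fin.castAdd_injective k l))]
      simp
    obtain ⟨a, rfl⟩ := exists_shufflePerm_eq S hS (hc S hS) hw' hwS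
    refine ⟨⟨⟨S, hS⟩, a, fun i h => ?_⟩, rfl⟩
    have := hw i (by omega) h
    rwa [shufflePerm_lt_iff _ _ _ _ (by omega) h,
      shufflePerm_lt_iff _ _ _ _ h (by omega)] at this

/-- `w` is up-down on its first `2 * j` entries and increasing from the last of these on, where
`1 ≤ j ≤ n`. -/
def IsUpDownThenIncreasing {n : ℕ} (j : ℕ) (w : Fin (2 * n) ≃ Fin (2 * n)) : Prop :=
  1 ≤ j ∧ j ≤ n ∧ IsUpDownBelow (2 * j) w ∧ IsIncreasingFrom (2 * j - 1) w

theorem isUpDownBelow_and_isIncreasingFrom_iff {n j : ℕ} (hn : 1 ≤ n) (hj : j ≤ n)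
    (w : Fin (2 * n) ≃ Fin (2 * n)) :
    IsUpDownBelow (2 * j) w ∧ IsIncreasingFrom (2 * j) w ↔
      IsUpDownThenIncreasing j w ∨ IsUpDownThenIncreasing (j + 1) w := by
  constructor
  · rintro ⟨hu, hi⟩
    by_cases hlast : 1 ≤ j ∧ ∀ h : 2 * j - 1 + 1 < 2 * n,
        w ⟨2 * j - 1, Nat.lt_of_succ_lt h⟩ < w ⟨2 * j - 1 + 1, h⟩
    · refine Or.inl ⟨hlast.1, hj, hu, fun i h hji => ?_⟩
      rcases hji.eq_or_lt with rfl | hji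
      · exact hlast.2 h
      · exact hi i h (by omega)
    · have hjn : j + 1 ≤ n := by
        by_contra hjn
        exact hlast ⟨by omega, fun h => by omega⟩
      refine Or.inr ⟨by omega, hjn, fun i h hij => ?_, fun i h hji => hi i h (by omega)⟩
      rcases lt_trichotomy (i + 1) (2 * j) with hlt | heq | hgt
      · exact hu i h hlt
      · obtain rfl : i = 2 * j - 1 := by omega
        refine ⟨fun he => by grind, fun _ => ?_⟩
        refine lt_of_le_of_ne (not_lt.1 fun hlt => hlast ⟨by omega, fun _ => hlt⟩) ?_
        intro he
        have := congrArg Fin.val (w.injective he)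
        simp at this
      · obtain rfl : i = 2 * j := by omega
        exact ⟨fun _ => hi _ h le_rfl, fun ho => by grind⟩
  · rintro (⟨-, -, hu, hi⟩ | ⟨-, hjn, hu, hi⟩)
    · exact ⟨hu, fun i h hji => hi i h (by omega)⟩
    · refine ⟨fun i h hij => hu i h (by omega), fun i h hji => ?_⟩
      rcases hji.eq_or_lt with rfl | hji
      · exact (hu _ h (by omega)).1 (even_two_mul j)
      · exact hi i h (by omega)

theorem IsUpDownThenIncreasing.not_succ {n j : ℕ} {w : Fin (2 * n) ≃ Fin (2 * n)}
    (h : IsUpDownThenIncreasing j w) : ¬ IsUpDownThenIncreasing (j + 1) w := by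
  rintro ⟨-, hjn, hu, -⟩
  obtain ⟨h1, -, -, hi⟩ := h
  have hlt : 2 * j - 1 + 1 < 2 * n := by omega
  exact lt_asymm (hi _ hlt le_rfl)
    ((hu _ hlt (by omega)).2 (Nat.Even.sub_odd (by omega) (even_two_mul j) odd_one))

theorem choose_mul_upDownCount_eq {n j : ℕ} (hn : 1 ≤ n) (hj : j ≤ n) :
    (2 * n).choose (2 * j) * upDownCount (2 * j) =
      Nat.card {w : Fin (2 * n) ≃ Fin (2 * n) // IsUpDownThenIncreasing j w} +
      Nat.card {w : Fin (2 * n) ≃ Fin (2 * n) // IsUpDownThenIncreasing (j + 1) w} := by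
  classical
  rw [← card_isUpDownBelow_isIncreasingFrom (by omega : 2 * j ≤ 2 * n)]
  simp only [isUpDownBelow_and_isIncreasingFrom_iff hn hj, Nat.card_eq_fintype_card]
  refine Fintype.card_subtype_or_disjoint (IsUpDownThenIncreasing j)
    (IsUpDownThenIncreasing (j + 1)) ?_
  rw [Pi.disjoint_iff]
  intro w
  rw [Prop.disjoint_iff]
  exact fun h => h.1.not_succ h.2

theorem sum_range_neg_one_pow_mul_add_succ (q : ℕ → ℤ) (n : ℕ) :
    ∑ j ∈ Finset.range n, (-1) ^ j * (q j + q (j + 1)) = q 0 - (-1) ^ n * q n := by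
  induction n with
  | zero => simp
  | succ n ih => rw [Finset.sum_range_succ, ih]; ring

/-- For `n ≥ 1`, `∑_{j=0}^{n} C(2n, 2j) * (-1)^j * U (2j) = 0`, where `U` counts
up-down permutations. -/
theorem upDownCount_alternating_sum_even (n : ℕ) (hn : 1 ≤ n) :
    ∑ j ∈ Finset.range (n + 1),
      ((2 * n).choose (2 * j) : ℤ) * (-1) ^ j * (upDownCount (2 * j) : ℤ) = 0 := by
  let q (j : ℕ) : ℤ :=
    Nat.card {w : Fin (2 * n) ≃ Fin (2 * n) // IsUpDownThenIncreasing j w}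
  have hq0 : q 0 = 0 := by simp [q, IsUpDownThenIncreasing]
  have hqn : q (n + 1) = 0 := by simp [q, IsUpDownThenIncreasing]
  calc
    _ = ∑ j ∈ Finset.range (n + 1), (-1) ^ j * (q j + q (j + 1)) := by
      refine Finset.sum_congr rfl fun j hj => ?_
      have h := choose_mul_upDownCount_eq hn (Finset.mem_range_succ_iff.1 hj)
      zify at h
      rw [← h]
      ring
    _ = 0 := by rw [sum_range_neg_one_pow_mul_add_succ, hq0, hqn]; simp
end
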